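/- arXiv:2402.13366 — 3 statements merged into one kernel-verified Lean document; each statement's English description precedes it below -/
import Mathlib

section
/- Consider a target model M₀ and a single source model M₁ (T = 1) with noise variances σ₁² < σ₀², and let g(δ) = c·log(e/δ) be such that the empirical mean of K i.i.d. samples from model M_t satisfies ‖θ̄_t(K) − θ_t‖² ≤ g(δ)·dσ_t²/K with probability at least 1 − δ. Let θ̃₀ = θ̄₀(N/2) and θ̃₁ = θ̄₁(N/2) be empirical means of N/2 i.i.d. samples from M₀ and M₁ respectively (the two batches independent), let δ ∈ (0,1), and define the estimator θ̂ := θ̃₀ if ‖θ̃₀ − θ̃₁‖² ≥ 10·g(δ)·dσ₀²/(N/2), and θ̂ := θ̃₁ otherwise. Then there exists a numerical constant ν ∈ [1/27, 1) such that, with probability at least 1 − δ, ‖θ̂ − θ₀‖² ≤ (8·g(δ/2)/ν)·min{ Q₁² + dσ₁²/N , dσ₀²/N }. -/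
open MeasureTheory ProbabilityTheory
open scoped Classical

/-- Squared Euclidean distance on `Fin d → ℝ`. -/
noncomputable def sqDist {d : ℕ} (x y : Fin d → ℝ) : ℝ := ∑ i, (x i - y i) ^ 2

/-- Empirical mean of `n` samples in `ℝ^d`. -/
noncomputable def empMean {d n : ℕ} (y : Fin n → Fin d → ℝ) : Fin d → ℝ :=
  fun i => (∑ k, y k i) / n

theorem sqDist_comm {d : ℕ} (x y : Fin d → ℝ) : sqDist x y = sqDist y x :=
  Finset.sum_congr rfl fun _ _ => by ring

theorem sqDist_nonneg {d : ℕ} (x y : Fin d → ℝ) : 0 ≤ sqDist x y :=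
  Finset.sum_nonneg fun _ _ => sq_nonneg _

theorem sqDist_le_two_mul_add {d : ℕ} (x y z : Fin d → ℝ) :
    sqDist x z ≤ 2 * (sqDist x y + sqDist y z) := by
  unfold sqDist
  rw [← Finset.sum_add_distrib, Finset.mul_sum]
  refine Finset.sum_le_sum fun i _ => ?_
  nlinarith [sq_nonneg ((x i - y i) - (y i - z i))]

theorem sqDist_le_three_mul_add {d : ℕ} (w x y z : Fin d → ℝ) :
    sqDist w z ≤ 3 * (sqDist w x + sqDist x y + sqDist y z) := by
  unfold sqDist
  rw [← Finset.sum_add_distrib, ← Finset.sum_add_distrib, Finset.mul_sum]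
  refine Finset.sum_le_sum fun i _ => ?_
  nlinarith [sq_nonneg ((w i - x i) - (x i - y i)), sq_nonneg ((x i - y i) - (y i - z i)),
    sq_nonneg ((w i - x i) - (y i - z i))]

theorem measurable_sqDist_empMean {d n : ℕ} (θ : Fin d → ℝ) :
    Measurable fun y : Fin n → Fin d → ℝ => sqDist (empMean y) θ := by
  unfold sqDist empMean
  fun_prop

/-- Union bound: two events of probability at least `1 - ε` both occur with probability at
least `1 - 2 * ε`. -/
theorem ofReal_one_sub_two_mul_le_measure_inter {Ω : Type*} [MeasurableSpace Ω] (P : Measure Ω)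
    [IsProbabilityMeasure P] {A B : Set Ω} (hB : MeasurableSet B) {ε : ℝ}
    (hPA : ENNReal.ofReal (1 - ε) ≤ P A)
    (hPB : ENNReal.ofReal (1 - ε) ≤ P B) :
    ENNReal.ofReal (1 - 2 * ε) ≤ P (A ∩ B) := by
  rw [ENNReal.ofReal_le_iff_le_toReal (measure_ne_top _ _), ← measureReal_def] at *
  have hunion := measureReal_union_add_inter (μ := P) (s := A) hB
  have hle : P.real (A ∪ B) ≤ 1 := measureReal_le_one
  linarith

/-- Loss of the two-batch selection rule when both empirical means `x` and `y` concentrate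
around `θ0` and `θ1`. -/
theorem sqDist_select_le {d : ℕ} {x y θ0 θ1 : Fin d → ℝ} {g G a s : ℝ} (hg1 : 1 ≤ g)
    (hgG : g ≤ G) (hGg : G ≤ 1.7 * g) (hs : 0 ≤ s) (ha : 0 ≤ a)
    (hx : sqDist x θ0 ≤ G * a) (hy : sqDist y θ1 ≤ G * s) :
    sqDist (if 10 * g * a ≤ sqDist x y then x else y) θ0 ≤
      216 * G * min (sqDist θ1 θ0 + s / 2) (a / 2) := by
  have hG : 1 ≤ G := hg1.trans hgG
  have hQ := sqDist_nonneg θ1 θ0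
  have hGa : 0 ≤ G * a := by positivity
  have hGs : 0 ≤ G * s := by positivity
  have hGQ : sqDist θ1 θ0 ≤ G * sqDist θ1 θ0 := le_mul_of_one_le_left hQ hG
  have hga : g * a ≤ G * a := mul_le_mul_of_nonneg_right hgG ha
  have hGga : G * a ≤ 1.7 * g * a := mul_le_mul_of_nonneg_right hGg ha
  rw [mul_min_of_nonneg _ _ (by positivity), le_min_iff]
  split_ifs with h
  · have htri := sqDist_le_three_mul_add x θ0 θ1 y
    rw [sqDist_comm θ0 θ1, sqDist_comm θ1 y] at htri
    constructor <;> linarith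
  · have h₁ := sqDist_le_two_mul_add y θ1 θ0
    have h₂ := sqDist_le_two_mul_add y x θ0
    rw [sqDist_comm y x] at h₂
    constructor <;> linarith

/-- **Theorem 1 (single source, high-probability bound).**
`n = N/2` samples are drawn from each of the target model `M₀` and the source model `M₁`
(the two batches independent); the estimator selects the target empirical mean if the two
empirical means are far apart, and the source empirical mean otherwise. With probability
at least `1 − δ` its loss is at most `(8 g(δ/2)/ν)·min{Q₁² + dσ₁²/N, dσ₀²/N}` for a
numerical constant `ν ∈ [1/27, 1)`. -/
theorem single_source_CL_high_prob (d n : ℕ) (hd : 0 < d) (hn : 0 < n)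
    (θ0 θ1 : Fin d → ℝ) (σ0 σ1 : ℝ) (hσ1 : 0 < σ1) (hσ01 : σ1 ^ 2 < σ0 ^ 2)
    (c : ℝ) (hc : 1 < c) (g : ℝ → ℝ) (hg : ∀ x, g x = c * Real.log (Real.exp 1 / x))
    (δ : ℝ) (hδ : δ ∈ Set.Ioo (0 : ℝ) 1)
    (P : Measure ((Fin n → Fin d → ℝ) × (Fin n → Fin d → ℝ)))
    (hP : P = (Measure.pi fun _ : Fin n => Measure.pi fun i : Fin d =>
                  gaussianReal (θ0 i) ((σ0 ^ 2).toNNReal)).prod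
              (Measure.pi fun _ : Fin n => Measure.pi fun i : Fin d =>
                  gaussianReal (θ1 i) ((σ1 ^ 2).toNNReal)))
    (hgood0 : ∀ δ' ∈ Set.Ioo (0 : ℝ) 1,
        P {ω | sqDist (empMean ω.1) θ0 ≤ g δ' * (d * σ0 ^ 2 / n)} ≥ ENNReal.ofReal (1 - δ'))
    (hgood1 : ∀ δ' ∈ Set.Ioo (0 : ℝ) 1,
        P {ω | sqDist (empMean ω.2) θ1 ≤ g δ' * (d * σ1 ^ 2 / n)} ≥ ENNReal.ofReal (1 - δ'))
    (θhat : ((Fin n → Fin d → ℝ) × (Fin n → Fin d → ℝ)) → Fin d → ℝ)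
    (hθhat : ∀ ω, θhat ω =
        if 10 * g δ * (d * σ0 ^ 2 / n) ≤ sqDist (empMean ω.1) (empMean ω.2)
        then empMean ω.1 else empMean ω.2) :
    ∃ ν : ℝ, ν ∈ Set.Ico (1 / 27 : ℝ) 1 ∧
      P {ω | sqDist (θhat ω) θ0 ≤
            8 * g (δ / 2) / ν *
              min (sqDist θ1 θ0 + d * σ1 ^ 2 / (2 * n)) (d * σ0 ^ 2 / (2 * n))}
        ≥ ENNReal.ofReal (1 - δ) := by
  obtain ⟨hδ0, hδ1⟩ := hδ
  have : IsProbabilityMeasure P := by rw [hP]; infer_instance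
  have hgδ : g δ = c * (1 - Real.log δ) := by
    rw [hg, Real.log_div (Real.exp_ne_zero _) hδ0.ne', Real.log_exp]
  have hgδ2 : g (δ / 2) = g δ + c * Real.log 2 := by
    rw [hgδ, hg, Real.log_div (Real.exp_ne_zero _) (by positivity), Real.log_exp,
      Real.log_div hδ0.ne' two_ne_zero]
    ring
  have hlogδ := Real.log_neg hδ0 hδ1
  have hcg : c ≤ g δ := by
    rw [hgδ]
    exact le_mul_of_one_le_right (by linarith) (by linarith)
  have hlog2 : c * Real.log 2 ≤ c * 0.7 :=
    mul_le_mul_of_nonneg_left (by linarith [Real.log_two_lt_d9]) (by linarith)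
  have hlog2' : 0 ≤ c * Real.log 2 := mul_nonneg (by linarith) (Real.log_nonneg one_le_two)
  have hδ2 : δ / 2 ∈ Set.Ioo (0 : ℝ) 1 := ⟨by linarith, by linarith⟩
  refine ⟨1 / 27, by norm_num, ?_⟩
  have hinter := ofReal_one_sub_two_mul_le_measure_inter P
    (measurableSet_le ((measurable_sqDist_empMean θ1).comp measurable_snd) measurable_const)
    (hgood0 _ hδ2) (hgood1 _ hδ2)
  rw [mul_div_cancel₀ δ two_ne_zero] at hinter
  refine hinter.trans (measure_mono ?_)
  rintro ω ⟨h₀, h₁⟩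
  have hloss := sqDist_select_le (g := g δ) (by linarith) (by linarith) (by linarith)
    (by positivity) (by positivity) h₀ h₁
  rw [Set.mem_ofPred_eq, hθhat]
  convert hloss using 2
  · ring
  · congr 1 <;> ring
end

section
/- Let Y(1), …, Y(K) be i.i.d. samples from Y = θ + ε with θ ∈ ℝ^d and ε ~ N(0, σ²·I_d), and define the sample-variance estimator σ̂²(K) := (1/(d(K−1)))·Σ_{i=1}^K ‖Y(i) − (1/K)·Σ_{i'=1}^K Y(i')‖². Then with probability at least 1 − 2·exp(−d(K−1)/24), it holds that (1/2)·σ² ≤ σ̂²(K) ≤ (3/2)·σ². -/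
open MeasureTheory ProbabilityTheory

section ChiSquare

lemma gaussianPDFReal_mul_exp_mul_sq (t x : ℝ) :
    gaussianPDFReal 0 1 x * Real.exp (t * x ^ 2) =
      (√(2 * Real.pi))⁻¹ * Real.exp (-(1 / 2 - t) * x ^ 2) := by
  simp only [gaussianPDFReal, NNReal.coe_one, mul_one, sub_zero]
  rw [mul_assoc, ← Real.exp_add]
  ring_nf

lemma integrable_exp_mul_sq_gaussianReal {t : ℝ} (ht : t < 1 / 2) :
    Integrable (fun x : ℝ ↦ Real.exp (t * x ^ 2)) (gaussianReal 0 1) := by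
  rw [gaussianReal_of_var_ne_zero _ one_ne_zero,
    integrable_withDensity_iff_integrable_smul' (measurable_gaussianPDF 0 1)
      (.of_forall fun _ ↦ gaussianPDF_lt_top)]
  simp only [toReal_gaussianPDF, smul_eq_mul, gaussianPDFReal_mul_exp_mul_sq]
  exact (integrable_exp_neg_mul_sq (by linarith)).const_mul _

lemma mgf_sq_gaussianReal {t : ℝ} (ht : t < 1 / 2) :
    mgf (fun x : ℝ ↦ x ^ 2) (gaussianReal 0 1) t = (√(1 - 2 * t))⁻¹ := by
  rw [mgf, integral_gaussianReal_eq_integral_smul one_ne_zero]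
  simp only [smul_eq_mul, gaussianPDFReal_mul_exp_mul_sq]
  rw [integral_const_mul, integral_gaussian, ← Real.sqrt_inv, ← Real.sqrt_inv,
    ← Real.sqrt_mul (by positivity)]
  congr 1
  have : 1 - 2 * t ≠ 0 := by linarith
  have : 1 / 2 - t ≠ 0 := by linarith
  field_simp [Real.pi_ne_zero]

variable {ι : Type*} [Fintype ι]

lemma iIndepFun_sq_eval_pi_gaussianReal :
    iIndepFun (fun (i : ι) (w : ι → ℝ) ↦ w i ^ 2) (Measure.pi fun _ : ι ↦ gaussianReal 0 1) :=
  iIndepFun_pi (X := fun _ x ↦ x ^ 2) fun _ ↦ by fun_prop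

lemma integrable_exp_mul_sum_sq (s : Finset ι) {t : ℝ} (ht : t < 1 / 2) :
    Integrable (fun w : ι → ℝ ↦ Real.exp (t * ∑ i ∈ s, w i ^ 2))
      (Measure.pi fun _ : ι ↦ gaussianReal 0 1) := by
  have h := iIndepFun_sq_eval_pi_gaussianReal.integrable_exp_mul_sum (t := t) (s := s)
    (fun i ↦ by fun_prop) fun i _ ↦
      (measurePreserving_eval (fun _ : ι ↦ gaussianReal 0 1) i).integrable_comp_of_integrable
        (integrable_exp_mul_sq_gaussianReal ht)
  simpa only [Finset.sum_apply] using h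

lemma mgf_sum_sq (s : Finset ι) {t : ℝ} (ht : t < 1 / 2) :
    mgf (fun w : ι → ℝ ↦ ∑ i ∈ s, w i ^ 2) (Measure.pi fun _ : ι ↦ gaussianReal 0 1) t =
      (√(1 - 2 * t))⁻¹ ^ s.card := by
  have h := iIndepFun_sq_eval_pi_gaussianReal.mgf_sum (t := t) (fun i : ι ↦ by fun_prop) s
  have hi (i : ι) : mgf (fun w : ι → ℝ ↦ w i ^ 2)
      (Measure.pi fun _ : ι ↦ gaussianReal 0 1) t = (√(1 - 2 * t))⁻¹ := by
    have he := measurePreserving_eval (fun _ : ι ↦ gaussianReal 0 1) i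
    rw [← mgf_sq_gaussianReal ht, mgf, mgf]
    nth_rw 2 [← he.map_eq]
    rw [integral_map he.measurable.aemeasurable (by fun_prop)]
  simp only [hi, Finset.prod_const] at h
  rw [← h]
  congr 1
  ext w
  simp

lemma measureReal_sum_sq_ge_le (s : Finset ι) :
    (Measure.pi fun _ : ι ↦ gaussianReal 0 1).real
      {w | 3 / 2 * (s.card : ℝ) ≤ ∑ i ∈ s, w i ^ 2} ≤ Real.exp (-s.card / 24) := by
  refine (measure_ge_le_exp_mul_mgf (t := 1 / 6) _ (by norm_num)
    (integrable_exp_mul_sum_sq s (by norm_num))).trans ?_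
  rw [mgf_sum_sq s (by norm_num)]
  have hsqrt : Real.exp (-(5 / 24)) ≤ √(1 - 2 * (1 / 6)) := by
    refine Real.le_sqrt_of_sq_le ?_
    rw [← Real.exp_nat_mul, ← inv_inv (1 - 2 * (1 / 6) : ℝ), mul_neg, Real.exp_neg]
    refine inv_anti₀ (by norm_num) (le_trans ?_ (Real.quadratic_le_exp_of_nonneg (by norm_num)))
    norm_num
  have hinv : (√(1 - 2 * (1 / 6)))⁻¹ ≤ Real.exp (5 / 24) := by
    rw [inv_le_comm₀ ((Real.exp_pos _).trans_le hsqrt) (Real.exp_pos _), ← Real.exp_neg]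
    exact hsqrt
  calc _ ≤ Real.exp (-(1 / 6) * (3 / 2 * s.card)) * Real.exp (5 / 24) ^ s.card := by gcongr
    _ = _ := by
      rw [← Real.exp_nat_mul, ← Real.exp_add]
      ring_nf

lemma measureReal_sum_sq_le_le (s : Finset ι) :
    (Measure.pi fun _ : ι ↦ gaussianReal 0 1).real
      {w | ∑ i ∈ s, w i ^ 2 ≤ 1 / 2 * (s.card : ℝ)} ≤ Real.exp (-s.card / 24) := by
  refine (measure_le_le_exp_mul_mgf (t := -(1 / 2)) _ (by norm_num)
    (integrable_exp_mul_sum_sq s (by norm_num))).trans ?_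
  rw [mgf_sum_sq s (by norm_num)]
  have hsqrt : Real.exp (7 / 24) ≤ √(1 - 2 * -(1 / 2)) := by
    refine Real.le_sqrt_of_sq_le ?_
    rw [← Real.exp_nat_mul, ← Real.le_log_iff_exp_le (by norm_num)]
    have := Real.log_two_gt_d9
    norm_num at this ⊢
    linarith
  have hinv : (√(1 - 2 * -(1 / 2)))⁻¹ ≤ Real.exp (-(7 / 24)) := by
    rw [Real.exp_neg]
    exact inv_anti₀ (Real.exp_pos _) hsqrt
  calc _ ≤ Real.exp (- -(1 / 2) * (1 / 2 * s.card)) * Real.exp (-(7 / 24)) ^ s.card := by gcongr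
    _ = _ := by
      rw [← Real.exp_nat_mul, ← Real.exp_add]
      ring_nf

lemma ofReal_le_measure_sum_sq_mem_Icc (s : Finset ι) :
    ENNReal.ofReal (1 - 2 * Real.exp (-s.card / 24)) ≤
      (Measure.pi fun _ : ι ↦ gaussianReal 0 1)
        {w | 1 / 2 * (s.card : ℝ) ≤ ∑ i ∈ s, w i ^ 2 ∧
          ∑ i ∈ s, w i ^ 2 ≤ 3 / 2 * (s.card : ℝ)} := by
  set P := Measure.pi fun _ : ι ↦ gaussianReal 0 1
  set A := {w : ι → ℝ | 1 / 2 * (s.card : ℝ) ≤ ∑ i ∈ s, w i ^ 2 ∧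
    ∑ i ∈ s, w i ^ 2 ≤ 3 / 2 * (s.card : ℝ)}
  have hA : MeasurableSet A := by
    simp only [A, Set.ofPred_and]
    exact (measurableSet_le (by fun_prop) (by fun_prop)).inter
      (measurableSet_le (by fun_prop) (by fun_prop))
  have hsub : Aᶜ ⊆ {w | 3 / 2 * (s.card : ℝ) ≤ ∑ i ∈ s, w i ^ 2} ∪
      {w | ∑ i ∈ s, w i ^ 2 ≤ 1 / 2 * (s.card : ℝ)} := fun w hw ↦ by
    by_contra h
    simp only [Set.mem_union, Set.mem_ofPred_eq, not_or, not_le] at h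
    exact hw ⟨h.2.le, h.1.le⟩
  have hcompl := (measureReal_mono (μ := P) hsub).trans (measureReal_union_le _ _)
  rw [probReal_compl_eq_one_sub hA] at hcompl
  have hge := measureReal_sum_sq_ge_le s
  have hle := measureReal_sum_sq_le_le s
  rw [← ofReal_measureReal (μ := P)]
  exact ENNReal.ofReal_le_ofReal (by linarith)

end ChiSquare

section Rotation

lemma measurePreserving_sum_smul_orthonormalBasis {ι : Type*} [Fintype ι]
    (b : OrthonormalBasis ι ℝ (EuclideanSpace ℝ ι)) :
    MeasurePreserving (fun w : ι → ℝ ↦ WithLp.ofLp (∑ i, w i • b i))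
      (Measure.pi fun _ ↦ gaussianReal 0 1) (Measure.pi fun _ ↦ gaussianReal 0 1) := by
  refine ⟨by fun_prop, ?_⟩
  have h : (fun w : ι → ℝ ↦ WithLp.ofLp (∑ i, w i • b i)) =
      WithLp.ofLp ∘ fun w : ι → ℝ ↦ ∑ i, w i • b i := rfl
  rw [h, ← Measure.map_map (by fun_prop) (by fun_prop),
    ← stdGaussian_eq_map_pi_orthonormalBasis b, ← map_pi_eq_stdGaussian,
    Measure.map_map (by fun_prop) (by fun_prop)]
  exact Measure.map_id

lemma measurePreserving_curry_pi {ι κ X : Type*} [Fintype ι] [Fintype κ] [MeasurableSpace X]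
    (μ : Measure X) [IsProbabilityMeasure μ] :
    MeasurePreserving (fun (x : ι × κ → X) i j ↦ x (i, j))
      (Measure.pi fun _ ↦ μ) (Measure.pi fun _ ↦ Measure.pi fun _ ↦ μ) := by
  refine ⟨by fun_prop, ?_⟩
  have h := Measure.infinitePi_map_curry (fun (_ : ι) (_ : κ) ↦ μ)
  simp only [Measure.infinitePi_eq_pi] at h
  exact h

lemma measurePreserving_const_add_mul_gaussianReal (m σ : ℝ) :
    MeasurePreserving (fun x ↦ m + σ * x) (gaussianReal 0 1)
      (gaussianReal m (σ ^ 2).toNNReal) := by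
  refine ⟨by fun_prop, ?_⟩
  have h : (fun x ↦ m + σ * x) = (fun x ↦ m + x) ∘ fun x ↦ σ * x := rfl
  rw [h, ← Measure.map_map (by fun_prop) (by fun_prop), gaussianReal_map_const_mul,
    gaussianReal_map_const_add]
  congr 1
  · simp
  · ext
    simp [Real.coe_toNNReal _ (sq_nonneg σ)]

lemma exists_orthonormalBasis_mean (ι κ : Type*) [Fintype ι] [Fintype κ] [DecidableEq κ]
    (j : ι) :
    ∃ b : OrthonormalBasis (ι × κ) ℝ (EuclideanSpace ℝ (ι × κ)),
      ∀ (i : κ) (x : EuclideanSpace ℝ (ι × κ)),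
        inner ℝ (b (j, i)) x = (√(Fintype.card ι))⁻¹ * ∑ k, x (k, i) := by
  let v : ι × κ → EuclideanSpace ℝ (ι × κ) := fun p ↦
    WithLp.toLp 2 fun q ↦ if q.2 = p.2 then (√(Fintype.card ι))⁻¹ else 0
  have hinner (p : ι × κ) (x : EuclideanSpace ℝ (ι × κ)) :
      inner ℝ (v p) x = (√(Fintype.card ι))⁻¹ * ∑ k, x (k, p.2) := by
    simp [v, PiLp.inner_apply, Fintype.sum_prod_type, Finset.mul_sum, mul_comm]
  have hcard : (0 : ℝ) < Fintype.card ι := by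
    exact_mod_cast Fintype.card_pos_iff.2 ⟨j⟩
  have hv : Orthonormal ℝ (({p | p.1 = j} : Set (ι × κ)).domRestrict v) := by
    classical
    rw [orthonormal_iff_ite]
    rintro ⟨⟨k, i⟩, hk⟩ ⟨⟨k', i'⟩, hk'⟩
    obtain rfl : k = j := hk
    obtain rfl : k' = k := hk'
    simp only [Set.domRestrict_apply, hinner]
    by_cases h : i = i'
    · subst h
      simp only [v, if_true, Finset.sum_const, Finset.card_univ, nsmul_eq_mul]
      field_simp
      rw [Real.sq_sqrt hcard.le]
    · simp [v, h]
  obtain ⟨b, hb⟩ := hv.exists_orthonormalBasis_extension_of_card_eq (by simp)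
  exact ⟨b, fun i x ↦ by rw [hb (j, i) rfl, hinner]⟩

end Rotation

lemma sum_sub_mean_sq {ι : Type*} [Fintype ι] [Nonempty ι] (x : ι → ℝ) :
    ∑ k, (x k - (∑ k', x k') / Fintype.card ι) ^ 2 =
      ∑ k, x k ^ 2 - (∑ k, x k) ^ 2 / Fintype.card ι := by
  have : (Fintype.card ι : ℝ) ≠ 0 := by simp
  simp only [sub_sq, Finset.sum_add_distrib, Finset.sum_sub_distrib, ← Finset.sum_mul,
    ← Finset.mul_sum, Finset.sum_const, Finset.card_univ, nsmul_eq_mul]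
  field_simp
  ring

lemma sum_sub_mean_sq_affine {ι : Type*} [Fintype ι] [Nonempty ι] (x : ι → ℝ) (m σ : ℝ) :
    ∑ k, (m + σ * x k - (∑ k', (m + σ * x k')) / Fintype.card ι) ^ 2 =
      σ ^ 2 * ∑ k, (x k - (∑ k', x k') / Fintype.card ι) ^ 2 := by
  have : (Fintype.card ι : ℝ) ≠ 0 := by simp
  rw [Finset.mul_sum]
  refine Finset.sum_congr rfl fun k _ ↦ ?_
  rw [Finset.sum_add_distrib, ← Finset.mul_sum, Finset.sum_const, Finset.card_univ, nsmul_eq_mul]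
  field_simp
  ring

lemma sum_sum_sub_mean_sq_of_orthonormalBasis {ι κ : Type*} [Fintype ι] [Fintype κ]
    [DecidableEq ι] {j : ι} {b : OrthonormalBasis (ι × κ) ℝ (EuclideanSpace ℝ (ι × κ))}
    (hb : ∀ (i : κ) (x : EuclideanSpace ℝ (ι × κ)),
      inner ℝ (b (j, i)) x = (√(Fintype.card ι))⁻¹ * ∑ k, x (k, i))
    (w : ι × κ → ℝ) {x : EuclideanSpace ℝ (ι × κ)} (hx : x = ∑ p, w p • b p) :
    ∑ k, ∑ i, (x (k, i) - (∑ k', x (k', i)) / Fintype.card ι) ^ 2 =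
      ∑ p ∈ (Finset.univ.erase j) ×ˢ Finset.univ, w p ^ 2 := by
  have : Nonempty ι := ⟨j⟩
  have hw (p : ι × κ) : inner ℝ (b p) x = w p := by
    rw [hx]
    exact b.orthonormal.inner_right_fintype w p
  have hnorm : ∑ k, ∑ i, x (k, i) ^ 2 = ∑ k, ∑ i, w (k, i) ^ 2 := by
    rw [← Fintype.sum_prod_type', ← Fintype.sum_prod_type', ← EuclideanSpace.real_norm_sq_eq,
      ← b.sum_sq_inner_right]
    simp only [hw]
  have hmean (i : κ) : (∑ k, x (k, i)) ^ 2 / Fintype.card ι = w (j, i) ^ 2 := by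
    rw [← hw, hb, mul_pow, inv_pow, Real.sq_sqrt (Nat.cast_nonneg _)]
    ring
  rw [Finset.sum_comm]
  simp only [fun i ↦ sum_sub_mean_sq fun k ↦ x (k, i), hmean, Finset.sum_sub_distrib]
  rw [Finset.sum_comm, hnorm, Finset.sum_product,
    ← Finset.add_sum_erase _ _ (Finset.mem_univ j)]
  ring

/-- **Multiplicative concentration of the sample-variance estimator** (isotropic noise).
For `K` i.i.d. samples from `Y = θ + ε`, `ε ~ N(0, σ²·I_d)`, the estimator
`σ̂²(K) = (1/(d(K−1)))·∑_k ‖Y(k) − Ȳ‖²` satisfies `σ²/2 ≤ σ̂²(K) ≤ 3σ²/2` with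
probability at least `1 − 2·exp(−d(K−1)/24)`. -/
theorem sample_variance_concentration (d K : ℕ) (hd : 0 < d) (hK : 2 ≤ K)
    (θ : Fin d → ℝ) (σ : ℝ) (hσ : 0 < σ) :
    (Measure.pi fun _ : Fin K => Measure.pi fun i : Fin d =>
        gaussianReal (θ i) ((σ ^ 2).toNNReal))
      {y : Fin K → Fin d → ℝ |
        1 / 2 * σ ^ 2 ≤
            1 / (d * ((K : ℝ) - 1)) * ∑ k, ∑ i, (y k i - (∑ k', y k' i) / K) ^ 2 ∧
        1 / (d * ((K : ℝ) - 1)) * ∑ k, ∑ i, (y k i - (∑ k', y k' i) / K) ^ 2 ≤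
            3 / 2 * σ ^ 2}
      ≥ ENNReal.ofReal (1 - 2 * Real.exp (-(d * ((K : ℝ) - 1)) / 24)) := by
  have hK1 : (0 : ℝ) < (K : ℝ) - 1 := by
    have : (2 : ℝ) ≤ K := by exact_mod_cast hK
    linarith
  have hd' : (0 : ℝ) < d := by exact_mod_cast hd
  let j : Fin K := ⟨0, by lia⟩
  obtain ⟨b, hb⟩ := exists_orthonormalBasis_mean (Fin K) (Fin d) j
  let s : Finset (Fin K × Fin d) := Finset.univ.erase j ×ˢ Finset.univ
  have hs : (s.card : ℝ) = d * ((K : ℝ) - 1) := by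
    simp [s, Finset.card_product, Nat.cast_sub (show 1 ≤ K by lia), mul_comm]
  have hΨ := ((measurePreserving_pi _ _ fun _ : Fin K ↦ measurePreserving_pi _ _ fun i : Fin d ↦
    measurePreserving_const_add_mul_gaussianReal (θ i) σ).comp
      (measurePreserving_curry_pi (gaussianReal 0 1))).comp
        (measurePreserving_sum_smul_orthonormalBasis b)
  rw [ge_iff_le, ← hΨ.measure_preimage (MeasurableSet.nullMeasurableSet ?_), ← hs]
  swap
  · rw [Set.ofPred_and]
    exact (measurableSet_le (by fun_prop) (by fun_prop)).inter
      (measurableSet_le (by fun_prop) (by fun_prop))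
  refine (ofReal_le_measure_sum_sq_mem_Icc s).trans (measure_mono fun w hw ↦ ?_)
  have : Nonempty (Fin K) := ⟨j⟩
  have hsum := sum_sum_sub_mean_sq_of_orthonormalBasis hb w rfl
  rw [Finset.sum_comm] at hsum
  have hpos : (0 : ℝ) < s.card := by rw [hs]; positivity
  have hcard : (K : ℝ) = Fintype.card (Fin K) := by simp
  simp only [Set.mem_preimage, Set.mem_ofPred_eq, Function.comp_apply]
  rw [Finset.sum_comm, hcard]
  simp only [sum_sub_mean_sq_affine, ← Finset.mul_sum, hsum]
  rw [one_div_mul_eq_div (s.card : ℝ), le_div_iff₀ hpos, div_le_iff₀ hpos]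
  have := sq_pos_of_pos hσ
  constructor
  · nlinarith [hw.1]
  · nlinarith [hw.2]
end

section
/- Let d = 1, let σ₀² ≥ σ₁² > 0 and q₁ ≥ 0. Consider estimators θ̂ that are measurable functions of N i.i.d. samples from N(θ₀, σ₀²) together with N i.i.d. samples from N(θ₁, σ₁²) (all samples independent). Then inf over such estimators of sup over pairs (θ₀, θ₁) ∈ ℝ² with |θ₁ − θ₀| ≤ q₁ of E[|θ̂ − θ₀|²] is at least (1/20)·min{ σ₀²/N , q₁² + σ₁²/N }. -/
open MeasureTheory ProbabilityTheory

open scoped ENNReal NNReal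

/-- A finite product of measures with densities has the product density. -/
lemma pi_withDensity {ι : Type*} [Fintype ι] {α : ι → Type*} [∀ i, MeasurableSpace (α i)]
    (μ : ∀ i, Measure (α i)) [∀ i, IsProbabilityMeasure (μ i)] (f : ∀ i, α i → ℝ≥0∞)
    (hf : ∀ i, Measurable (f i)) [∀ i, SigmaFinite ((μ i).withDensity (f i))] :
    Measure.pi (fun i => (μ i).withDensity (f i)) =
      (Measure.pi μ).withDensity (fun x => ∏ i, f i (x i)) := by
  classical
  refine Measure.pi_eq fun s hs => ?_
  rw [withDensity_apply _ (MeasurableSet.univ_pi hs),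
    ← lintegral_indicator (MeasurableSet.univ_pi hs)]
  have hind : (Set.univ.pi s).indicator (fun x => ∏ i, f i (x i)) =
      fun x => ∏ i, (s i).indicator (f i) (x i) := by
    ext x
    by_cases hx : x ∈ Set.univ.pi s
    · rw [Set.indicator_of_mem hx]
      exact Finset.prod_congr rfl fun i _ => (Set.indicator_of_mem (hx i trivial) _).symm
    · rw [Set.indicator_of_notMem hx]
      simp only [Set.mem_univ_pi, not_forall] at hx
      obtain ⟨i, hi⟩ := hx
      exact (Finset.prod_eq_zero (Finset.mem_univ i) (Set.indicator_of_notMem hi _)).symm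
  have hmeas : ∀ i, Measurable ((s i).indicator (f i)) := fun i => (hf i).indicator (hs i)
  rw [hind, lintegral_prod_eq_prod_lintegral_of_indepFun Finset.univ
    (fun i (x : ∀ i, α i) => (s i).indicator (f i) (x i))
    (iIndepFun_pi fun i => (hmeas i).aemeasurable)
    (fun i => (hmeas i).comp (measurable_pi_apply i))]
  refine Finset.prod_congr rfl fun i _ => ?_
  rw [(measurePreserving_eval μ i).lintegral_comp (hmeas i), lintegral_indicator (hs i),
    withDensity_apply _ (hs i)]

/-- The Gaussian `N(m, v)` has an exponential density with respect to `N(0, v)`. -/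
lemma gaussianReal_eq_withDensity_exp (m : ℝ) {v : ℝ≥0} (hv : v ≠ 0) :
    gaussianReal m v = (gaussianReal 0 v).withDensity
      (fun x => ENNReal.ofReal (Real.exp (m * x / v - m ^ 2 / (2 * v)))) := by
  rw [gaussianReal_of_var_ne_zero _ hv, gaussianReal_of_var_ne_zero _ hv,
    ← withDensity_mul _ (measurable_gaussianPDF 0 v) (by fun_prop)]
  congr 1
  ext x
  have hv' : (v : ℝ) ≠ 0 := by exact_mod_cast hv
  rw [Pi.mul_apply, gaussianPDF, gaussianPDF,
    ← ENNReal.ofReal_mul (gaussianPDFReal_nonneg _ _ _), gaussianPDFReal, gaussianPDFReal,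
    mul_assoc (√(2 * Real.pi * v))⁻¹, ← Real.exp_add]
  congr 3
  field_simp
  ring

/-- The law of an i.i.d. Gaussian sample has an exponential density with respect to the law of
the centred sample. -/
lemma pi_gaussianReal_eq_withDensity_exp (N : ℕ) (m : ℝ) {v : ℝ≥0} (hv : v ≠ 0) :
    Measure.pi (fun _ : Fin N => gaussianReal m v) =
      (Measure.pi fun _ : Fin N => gaussianReal 0 v).withDensity
        (fun x => ENNReal.ofReal (Real.exp (∑ i, (m * x i / v - m ^ 2 / (2 * v))))) := by
  have h := gaussianReal_eq_withDensity_exp m hv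
  have : SigmaFinite ((gaussianReal 0 v).withDensity
      (fun x => ENNReal.ofReal (Real.exp (m * x / v - m ^ 2 / (2 * v))))) := h ▸ inferInstance
  rw [h, pi_withDensity _ _ fun _ => by fun_prop]
  congr 1
  ext x
  rw [Real.exp_sum, ENNReal.ofReal_prod_of_nonneg fun i _ => (Real.exp_pos _).le]

/-- Two-point lower bound: if two probability measures have densities `f` and `g` whose product
is the constant `c`, then no function estimates both `δ` and `-δ` with squared risk below
`δ ^ 2 * c`. -/
lemma ofReal_sq_mul_le_of_two_point {Ω : Type*} [MeasurableSpace Ω] (μ : Measure Ω)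
    [IsProbabilityMeasure μ] {f g : Ω → ℝ} (hf : Measurable f) (hg : Measurable g)
    (hf0 : ∀ z, 0 ≤ f z) (hg0 : ∀ z, 0 ≤ g z) {c : ℝ} (hfg : ∀ z, f z * g z = c)
    (hf1 : IsProbabilityMeasure (μ.withDensity fun z => ENNReal.ofReal (f z)))
    (hg1 : IsProbabilityMeasure (μ.withDensity fun z => ENNReal.ofReal (g z)))
    {T : Ω → ℝ} (hT : Measurable T) {δ : ℝ} {R : ℝ≥0∞}
    (h1 : ∫⁻ z, ENNReal.ofReal ((T z - δ) ^ 2)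
      ∂(μ.withDensity fun z => ENNReal.ofReal (f z)) ≤ R)
    (h2 : ∫⁻ z, ENNReal.ofReal ((T z - -δ) ^ 2)
      ∂(μ.withDensity fun z => ENNReal.ofReal (g z)) ≤ R) :
    ENNReal.ofReal (δ ^ 2 * c) ≤ R := by
  obtain rfl | hR := eq_or_ne R ∞
  · exact le_top
  have hc : 0 ≤ c := by
    obtain ⟨z⟩ := nonempty_of_isProbabilityMeasure μ
    exact hfg z ▸ mul_nonneg (hf0 z) (hg0 z)
  have hone : ∀ {h : Ω → ℝ}, IsProbabilityMeasure (μ.withDensity fun z => ENNReal.ofReal (h z)) →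
      ∫⁻ z, ENNReal.ofReal (h z) ∂μ = 1 := fun hp => by
    rw [← setLIntegral_univ, ← withDensity_apply _ MeasurableSet.univ]
    exact hp.measure_univ
  have hpt : ∀ z, 4 * (δ ^ 2 * c) ≤
      f z * (T z - δ) ^ 2 + g z * (T z - -δ) ^ 2 + δ ^ 2 * c * (f z + g z) := by
    intro z
    have hfz := hf0 z
    have hgz := hg0 z
    rw [← hfg z]
    rcases (add_nonneg hfz hgz).eq_or_lt with hs | hs
    · have hf' : f z = 0 := by linarith
      have hg' : g z = 0 := by linarith
      simp [hf', hg']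
    · refine sub_nonneg.1 ((mul_nonneg_iff_of_pos_left hs).1 ?_)
      have hid : (f z + g z) * (f z * (T z - δ) ^ 2 + g z * (T z - -δ) ^ 2
          + δ ^ 2 * (f z * g z) * (f z + g z) - 4 * (δ ^ 2 * (f z * g z))) =
          (f z * (T z - δ) + g z * (T z + δ)) ^ 2
            + δ ^ 2 * (f z * g z) * (f z + g z - 2) ^ 2 := by ring
      rw [hid]
      positivity
  rw [lintegral_withDensity_eq_lintegral_mul _ hf.ennreal_ofReal (by fun_prop)] at h1
  rw [lintegral_withDensity_eq_lintegral_mul _ hg.ennreal_ofReal (by fun_prop)] at h2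
  simp only [Pi.mul_apply] at h1 h2
  have hint : ENNReal.ofReal (4 * (δ ^ 2 * c)) ≤ R + R + ENNReal.ofReal (δ ^ 2 * c) * (1 + 1) := by
    calc ENNReal.ofReal (4 * (δ ^ 2 * c))
        = ∫⁻ _, ENNReal.ofReal (4 * (δ ^ 2 * c)) ∂μ := by simp
      _ ≤ ∫⁻ z, (ENNReal.ofReal (f z) * ENNReal.ofReal ((T z - δ) ^ 2)
            + ENNReal.ofReal (g z) * ENNReal.ofReal ((T z - -δ) ^ 2)
            + ENNReal.ofReal (δ ^ 2 * c) * (ENNReal.ofReal (f z) + ENNReal.ofReal (g z))) ∂μ := by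
          refine lintegral_mono fun z => ?_
          have hfz := hf0 z
          have hgz := hg0 z
          dsimp only
          rw [← ENNReal.ofReal_mul hfz, ← ENNReal.ofReal_mul hgz, ← ENNReal.ofReal_add hfz hgz,
            ← ENNReal.ofReal_mul (by positivity),
            ← ENNReal.ofReal_add (by positivity) (by positivity),
            ← ENNReal.ofReal_add (by positivity) (by positivity)]
          exact ENNReal.ofReal_le_ofReal (hpt z)
      _ ≤ R + R + ENNReal.ofReal (δ ^ 2 * c) * (1 + 1) := by
          rw [lintegral_add_left (by fun_prop), lintegral_add_left (by fun_prop),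
            lintegral_const_mul _ (by fun_prop), lintegral_add_left (by fun_prop),
            hone hf1, hone hg1]
          gcongr
  lift R to ℝ≥0 using hR
  have hd : 0 ≤ δ ^ 2 * c := by positivity
  rw [← ENNReal.ofReal_coe_nnreal] at hint ⊢
  have h11 : (1 + 1 : ℝ≥0∞) = ENNReal.ofReal 2 := by norm_num
  rw [h11, ← ENNReal.ofReal_mul hd, ← ENNReal.ofReal_add R.coe_nonneg R.coe_nonneg,
    ← ENNReal.ofReal_add (by positivity) (by positivity),
    ENNReal.ofReal_le_ofReal_iff (by positivity)] at hint
  exact ENNReal.ofReal_le_ofReal (by linarith)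

/-- Two-point lower bound for the pairs `(δ, η)` and `(-δ, -η)` of means, when an i.i.d. Gaussian
sample is observed from each of the two models. -/
lemma ofReal_sq_mul_exp_le_of_gaussian_two_point (N : ℕ) {v w : ℝ≥0} (hv : v ≠ 0) (hw : w ≠ 0)
    (δ η : ℝ) {T : (Fin N → ℝ) × (Fin N → ℝ) → ℝ} (hT : Measurable T) {R : ℝ≥0∞}
    (h1 : ∫⁻ z, ENNReal.ofReal ((T z - δ) ^ 2)
      ∂((Measure.pi fun _ : Fin N => gaussianReal δ v).prod
        (Measure.pi fun _ : Fin N => gaussianReal η w)) ≤ R)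
    (h2 : ∫⁻ z, ENNReal.ofReal ((T z - -δ) ^ 2)
      ∂((Measure.pi fun _ : Fin N => gaussianReal (-δ) v).prod
        (Measure.pi fun _ : Fin N => gaussianReal (-η) w)) ≤ R) :
    ENNReal.ofReal (δ ^ 2 * Real.exp (-(N * (δ ^ 2 / v + η ^ 2 / w)))) ≤ R := by
  let L : ℝ → ℝ → (Fin N → ℝ) × (Fin N → ℝ) → ℝ := fun a b z =>
    Real.exp (∑ i, (a * z.1 i / v - a ^ 2 / (2 * v)))
      * Real.exp (∑ i, (b * z.2 i / w - b ^ 2 / (2 * w)))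
  have hL : ∀ a b, Measurable (L a b) := fun a b => by fun_prop
  have hL0 : ∀ a b z, 0 ≤ L a b z := fun a b z => by positivity
  have hden : ∀ a b, (Measure.pi fun _ : Fin N => gaussianReal a v).prod
      (Measure.pi fun _ : Fin N => gaussianReal b w) =
      ((Measure.pi fun _ : Fin N => gaussianReal 0 v).prod
        (Measure.pi fun _ : Fin N => gaussianReal 0 w)).withDensity
          fun z => ENNReal.ofReal (L a b z) := by
    intro a b
    rw [pi_gaussianReal_eq_withDensity_exp N a hv, pi_gaussianReal_eq_withDensity_exp N b hw,
      prod_withDensity (by fun_prop) (by fun_prop)]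
    congr 1
    ext z
    rw [← ENNReal.ofReal_mul (Real.exp_pos _).le]
  have hp : ∀ a b, IsProbabilityMeasure
      (((Measure.pi fun _ : Fin N => gaussianReal 0 v).prod
        (Measure.pi fun _ : Fin N => gaussianReal 0 w)).withDensity
          fun z => ENNReal.ofReal (L a b z)) := fun a b => hden a b ▸ inferInstance
  rw [hden] at h1 h2
  refine ofReal_sq_mul_le_of_two_point _ (hL δ η) (hL (-δ) (-η)) (hL0 _ _) (hL0 _ _)
    (fun z => ?_) (hp _ _) (hp _ _) hT h1 h2
  have hsum : ∀ (a u : ℝ) (x : Fin N → ℝ), ∑ i, (a * x i / u - a ^ 2 / (2 * u))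
      + ∑ i, (-a * x i / u - (-a) ^ 2 / (2 * u)) = -(N * (a ^ 2 / u)) := by
    intro a u x
    rw [← Finset.sum_add_distrib, Finset.sum_congr rfl (g := fun _ => -(a ^ 2 / u))
      fun i _ => by ring]
    simp
  dsimp only [L]
  rw [mul_mul_mul_comm, ← Real.exp_add, ← Real.exp_add, ← Real.exp_add, hsum, hsum]
  congr 1
  ring

/-- A choice of means at which the two-point bound is of the order of the minimax rate. -/
lemma exists_two_point_rate {a b q : ℝ} (hb : 0 < b) (hba : b ≤ a) (hq : 0 ≤ q) :
    ∃ δ η : ℝ, |η - δ| ≤ q ∧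
      1 / 20 * min a (q ^ 2 + b) ≤ δ ^ 2 * Real.exp (-(δ ^ 2 / a + η ^ 2 / b)) := by
  have ha : 0 < a := hb.trans_le hba
  have he1 : 1 / 10 ≤ Real.exp (-2) := by
    have h := Real.exp_one_lt_d9
    rw [Real.exp_neg, one_div]
    refine inv_anti₀ (Real.exp_pos _) ?_
    rw [show (2 : ℝ) = 1 + 1 by norm_num, Real.exp_add]
    nlinarith [Real.exp_pos 1]
  rcases le_total b (q ^ 2) with hbq | hbq
  · have hm : 0 ≤ min a (q ^ 2) := by positivity
    refine ⟨√(min a (q ^ 2)), 0, ?_, ?_⟩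
    · rw [zero_sub, abs_neg, abs_of_nonneg (Real.sqrt_nonneg _)]
      exact Real.sqrt_le_iff.2 ⟨hq, min_le_right _ _⟩
    · rw [Real.sq_sqrt hm]
      have hexp : Real.exp (-2) ≤ Real.exp (-(min a (q ^ 2) / a + 0 ^ 2 / b)) := by
        have : min a (q ^ 2) / a ≤ 1 := (div_le_one ha).2 (min_le_left _ _)
        refine Real.exp_le_exp.2 ?_
        simp only [ne_eq, OfNat.ofNat_ne_zero, not_false_eq_true, zero_pow, zero_div, add_zero]
        linarith
      have hmin : min a (q ^ 2 + b) ≤ 2 * min a (q ^ 2) := by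
        rcases min_cases a (q ^ 2) with h | h <;> rcases min_cases a (q ^ 2 + b) with h' | h' <;>
          linarith
      nlinarith [mul_le_mul_of_nonneg_left (he1.trans hexp) hm]
  · refine ⟨√b, √b, by simpa using hq, ?_⟩
    rw [Real.sq_sqrt hb.le, div_self hb.ne']
    have hexp : Real.exp (-2) ≤ Real.exp (-(b / a + 1)) := by
      have : b / a ≤ 1 := (div_le_one ha).2 hba
      exact Real.exp_le_exp.2 (by linarith)
    nlinarith [mul_le_mul_of_nonneg_left (he1.trans hexp) hb.le, min_le_right a (q ^ 2 + b)]

/-- **Minimax lower bound, one source model (`T = 1`, `d = 1`).**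
The learner observes `N` i.i.d. samples from the target model `N(θ₀, σ₀²)` and `N`
i.i.d. samples from the source model `N(θ₁, σ₁²)` (all independent), knows `|θ₁ − θ₀| ≤ q₁`,
and estimates `θ₀` under squared error.  The minimax risk is at least
`(1/20)·min{σ₀²/N, q₁² + σ₁²/N}`. -/
theorem minimax_lower_single_source (N : ℕ) (hN : 0 < N)
    (σ0 σ1 q1 : ℝ) (hσ1 : 0 < σ1) (hσ01 : σ1 ^ 2 ≤ σ0 ^ 2) (hq1 : 0 ≤ q1) :
    ENNReal.ofReal (1 / 20 * min (σ0 ^ 2 / N) (q1 ^ 2 + σ1 ^ 2 / N)) ≤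
      ⨅ (θhat : (Fin N → ℝ) × (Fin N → ℝ) → ℝ) (_ : Measurable θhat),
        ⨆ (p : ℝ × ℝ) (_ : |p.2 - p.1| ≤ q1),
          ∫⁻ z, ENNReal.ofReal ((θhat z - p.1) ^ 2)
            ∂((Measure.pi fun _ : Fin N => gaussianReal p.1 ((σ0 ^ 2).toNNReal)).prod
               (Measure.pi fun _ : Fin N => gaussianReal p.2 ((σ1 ^ 2).toNNReal))) := by
  have hN' : (0 : ℝ) < N := by exact_mod_cast hN
  have hs1 : 0 < σ1 ^ 2 := by positivity
  have hs0 : 0 < σ0 ^ 2 := hs1.trans_le hσ01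
  obtain ⟨δ, η, hδη, hrate⟩ := exists_two_point_rate (a := σ0 ^ 2 / N) (b := σ1 ^ 2 / N)
    (by positivity) (by gcongr) hq1
  refine le_iInf₂ fun T hT => ?_
  refine (ENNReal.ofReal_le_ofReal hrate).trans ?_
  have key := ofReal_sq_mul_exp_le_of_gaussian_two_point N
    (Real.toNNReal_pos.2 hs0).ne' (Real.toNNReal_pos.2 hs1).ne' δ η hT
    (le_iSup₂ (f := fun (p : ℝ × ℝ) (_ : |p.2 - p.1| ≤ q1) =>
      ∫⁻ z, ENNReal.ofReal ((T z - p.1) ^ 2)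
        ∂((Measure.pi fun _ : Fin N => gaussianReal p.1 ((σ0 ^ 2).toNNReal)).prod
          (Measure.pi fun _ : Fin N => gaussianReal p.2 ((σ1 ^ 2).toNNReal)))) (δ, η) hδη)
    (le_iSup₂ (f := fun (p : ℝ × ℝ) (_ : |p.2 - p.1| ≤ q1) =>
      ∫⁻ z, ENNReal.ofReal ((T z - p.1) ^ 2)
        ∂((Measure.pi fun _ : Fin N => gaussianReal p.1 ((σ0 ^ 2).toNNReal)).prod
          (Measure.pi fun _ : Fin N => gaussianReal p.2 ((σ1 ^ 2).toNNReal)))) (-δ, -η)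
      (by rwa [neg_sub_neg, abs_sub_comm]))
  rw [Real.coe_toNNReal _ hs0.le, Real.coe_toNNReal _ hs1.le] at key
  have hexp : δ ^ 2 / (σ0 ^ 2 / N) + η ^ 2 / (σ1 ^ 2 / N) =
      N * (δ ^ 2 / σ0 ^ 2 + η ^ 2 / σ1 ^ 2) := by
    rw [div_div_eq_mul_div, div_div_eq_mul_div]
    ring
  rwa [hexp]
end
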